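/- arXiv:2003.03129 — 8 statements merged into one kernel-verified Lean document; each statement's English description precedes it below -/
import Mathlib

section
/- Let (X, d_X) and (U, d_U) be metric spaces equipped with their Borel σ-algebras, let β ∈ (0,1], p ≥ 1, and let T : X → U be Borel measurable and locally β-Hölder with reference point x₀ ∈ X and nondecreasing function C_S : [0,∞) → [0,∞). Let P, Q ∈ P_{2βp}(X) be Borel probability measures satisfying ∫ C_S(d_X(x,x₀))^{2p} dP(x) ≤ C and ∫ C_S(d_X(x,x₀))^{2p} dQ(x) ≤ C for some finite constant C. Then the pushforward measures satisfy d_p(T_*P, T_*Q) ≤ 2 · C^{1/(2p)} · d_{2βp}(P, Q)^β. -/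
open MeasureTheory
open scoped ENNReal

/-- The `r`-Wasserstein distance between two Borel measures on a metric space:
the infimum over couplings `π` of `P` and `Q` of `(∫∫ d(x,y)^r dπ)^{1/r}`. -/
noncomputable def wassersteinDist {X : Type*} [MetricSpace X] [MeasurableSpace X]
    (r : ℝ) (P Q : Measure X) : ℝ≥0∞ :=
  ⨅ (π : Measure (X × X)) (_ : π.map Prod.fst = P ∧ π.map Prod.snd = Q),
    (∫⁻ q, edist q.1 q.2 ^ r ∂π) ^ (1 / r)

/-- `P` belongs to the Wasserstein space `P_r(X)`: it has a finite `r`-th moment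
of the distance to some reference point. -/
def memWassersteinSpace {X : Type*} [MetricSpace X] [MeasurableSpace X]
    (r : ℝ) (P : Measure X) : Prop :=
  ∃ x₀ : X, ∫⁻ x, edist x x₀ ^ r ∂P < ⊤

/-- Cauchy-Schwarz for the lower integral, with only one factor measurable. -/
theorem lintegral_mul_le_sq_aux {Ω : Type*} [MeasurableSpace Ω] (μ : Measure Ω)
    (f g : Ω → ℝ≥0∞) (hf : Measurable f) (hft : ∀ x, f x ≠ ⊤) :
    ∫⁻ x, f x * g x ∂μ ≤
      (∫⁻ x, f x ^ (2:ℝ) ∂μ) ^ (1 / (2:ℝ)) * (∫⁻ x, g x ^ (2:ℝ) ∂μ) ^ (1 / (2:ℝ)) := by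
  obtain ⟨h, hm, hle, heq⟩ := exists_measurable_le_lintegral_eq μ (fun x => f x * g x)
  rw [heq]
  have h1 : ∀ x, h x = f x * (h x / f x) := by
    intro x
    by_cases h0 : f x = 0
    · have := hle x
      simp only [h0, zero_mul, nonpos_iff_eq_zero] at this
      simp [h0, this]
    · exact (ENNReal.mul_div_cancel h0 (hft x)).symm
  have h2 : ∀ x, h x / f x ≤ g x := by
    intro x
    apply ENNReal.div_le_of_le_mul
    rw [mul_comm]; exact hle x
  calc ∫⁻ x, h x ∂μ = ∫⁻ x, (f * fun x => h x / f x) x ∂μ := lintegral_congr h1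
    _ ≤ (∫⁻ x, f x ^ (2:ℝ) ∂μ) ^ (1 / (2:ℝ)) * (∫⁻ x, (h x / f x) ^ (2:ℝ) ∂μ) ^ (1 / (2:ℝ)) :=
        ENNReal.lintegral_mul_le_Lp_mul_Lq μ Real.HolderConjugate.two_two
          hf.aemeasurable (hm.div hf).aemeasurable
    _ ≤ _ := by
        gcongr with x
        exact h2 x

/-- for a measurable, locally `β`-Hölder map `T` (reference point `x₀`,
nondecreasing local Hölder constant `CS`) and probability measures
`P, Q ∈ P_{2βp}(X)` whose `2p`-th moments of `CS(d(·,x₀))` are bounded by `C`,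
one has `d_p(T_*P, T_*Q) ≤ 2 · C^{1/(2p)} · d_{2βp}(P,Q)^β`. -/
theorem wasserstein_map_locally_holder {X U : Type*}
    [MetricSpace X] [MeasurableSpace X] [BorelSpace X]
    [MetricSpace U] [MeasurableSpace U] [BorelSpace U]
    (β p C : ℝ) (hβ0 : 0 < β) (hβ1 : β ≤ 1) (hp : 1 ≤ p) (hC : 0 ≤ C)
    (x₀ : X) (CS : ℝ → ℝ) (hCS0 : ∀ r, 0 ≤ CS r) (hCSmono : MonotoneOn CS (Set.Ici 0))
    (T : X → U) (hTm : Measurable T)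
    (hT : ∀ r : ℝ, 0 < r → ∀ x y : X, dist x x₀ ≤ r → dist y x₀ ≤ r →
      dist (T x) (T y) ≤ CS r * dist x y ^ β)
    (P Q : Measure X) [IsProbabilityMeasure P] [IsProbabilityMeasure Q]
    (hP : memWassersteinSpace (2 * β * p) P) (hQ : memWassersteinSpace (2 * β * p) Q)
    (hPC : ∫⁻ x, ENNReal.ofReal (CS (dist x x₀) ^ (2 * p)) ∂P ≤ ENNReal.ofReal C)
    (hQC : ∫⁻ x, ENNReal.ofReal (CS (dist x x₀) ^ (2 * p)) ∂Q ≤ ENNReal.ofReal C) :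
    wassersteinDist p (P.map T) (Q.map T)
      ≤ ENNReal.ofReal (2 * C ^ (1 / (2 * p))) * wassersteinDist (2 * β * p) P Q ^ β := by
  have hp0 : 0 < p := by linarith
  set K := ENNReal.ofReal (2 * C ^ (1 / (2 * p))) with hK
  -- the bound for each coupling
  have key : ∀ π : Measure (X × X), π.map Prod.fst = P → π.map Prod.snd = Q →
      wassersteinDist p (P.map T) (Q.map T) ≤
        K * ((∫⁻ q, edist q.1 q.2 ^ (2 * β * p) ∂π) ^ (1 / (2 * β * p))) ^ β := by
    intro π h1 h2
    have hTT : Measurable (fun q : X × X => (T q.1, T q.2)) := by fun_prop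
    have hle : wassersteinDist p (P.map T) (Q.map T) ≤
        (∫⁻ q, edist q.1 q.2 ^ p ∂(π.map (fun q : X × X => (T q.1, T q.2)))) ^ (1 / p) := by
      refine iInf₂_le _ ⟨?_, ?_⟩
      · rw [Measure.map_map measurable_fst hTT, ← h1, Measure.map_map hTm measurable_fst]; rfl
      · rw [Measure.map_map measurable_snd hTT, ← h2, Measure.map_map hTm measurable_snd]; rfl
    -- the Hölder weight
    have hCm : Measurable (fun r => CS (max r 0)) := by
      apply Monotone.measurable
      intro a b hab
      exact hCSmono (by simp) (by simp) (max_le_max hab le_rfl)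
    have hdm : Measurable (fun x : X => dist x x₀) :=
      (continuous_id.dist continuous_const).measurable
    have hCd : Measurable (fun x : X => CS (dist x x₀)) := by
      have := hCm.comp hdm
      convert this using 2 with x
      simp
    let c : X → ℝ≥0∞ := fun x => ENNReal.ofReal (CS (dist x x₀))
    have hcm : Measurable c := hCd.ennreal_ofReal
    let F : X × X → ℝ≥0∞ := fun q => max (c q.1) (c q.2)
    have hFm : Measurable F := (hcm.comp measurable_fst).max (hcm.comp measurable_snd)
    have hFt : ∀ q, F q ≠ ⊤ := by
      intro q; simp [F, c]
    have hpt : ∀ q : X × X, edist (T q.1) (T q.2) ≤ F q * edist q.1 q.2 ^ β := by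
      rintro ⟨x, y⟩
      by_cases hxy : x = y
      · simp [hxy]
      have hr : 0 < max (dist x x₀) (dist y x₀) := by
        by_contra hcon
        push Not at hcon
        have hx := le_trans (le_max_left _ _) hcon
        have hy := le_trans (le_max_right _ _) hcon
        exact hxy ((dist_le_zero.1 hx).trans (dist_le_zero.1 hy).symm)
      have := hT _ hr x y (le_max_left _ _) (le_max_right _ _)
      have hF : F (x, y) = ENNReal.ofReal (CS (max (dist x x₀) (dist y x₀))) := by
        rcases le_total (dist x x₀) (dist y x₀) with h | h
        · rw [max_eq_right h]
          exact max_eq_right (ENNReal.ofReal_le_ofReal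
            (hCSmono dist_nonneg dist_nonneg h))
        · rw [max_eq_left h]
          exact max_eq_left (ENNReal.ofReal_le_ofReal
            (hCSmono dist_nonneg dist_nonneg h))
      rw [hF, edist_dist, edist_dist, ENNReal.ofReal_rpow_of_nonneg dist_nonneg hβ0.le,
        ← ENNReal.ofReal_mul (hCS0 _)]
      exact ENNReal.ofReal_le_ofReal this
    have hcpow : ∀ x, c x ^ (2 * p) = ENNReal.ofReal (CS (dist x x₀) ^ (2 * p)) := fun x =>
      ENNReal.ofReal_rpow_of_nonneg (hCS0 _) (by positivity)
    have hcpm : Measurable (fun x => c x ^ (2 * p)) := hcm.pow_const _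
    have hFint : ∫⁻ q, F q ^ (2 * p) ∂π ≤ 2 * ENNReal.ofReal C := by
      calc ∫⁻ q, F q ^ (2 * p) ∂π ≤ ∫⁻ q, (c q.1 ^ (2 * p) + c q.2 ^ (2 * p)) ∂π := by
            apply lintegral_mono
            intro q
            rcases le_total (c q.1) (c q.2) with h | h
            · simp only [F, max_eq_right h]; exact le_add_self
            · simp only [F, max_eq_left h]; exact le_self_add
        _ = ∫⁻ x, c x ^ (2 * p) ∂P + ∫⁻ x, c x ^ (2 * p) ∂Q := by
            rw [lintegral_add_left (show Measurable fun q : X × X => c q.1 ^ (2 * p) from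
              hcpm.comp measurable_fst), ← h1, ← h2,
              lintegral_map hcpm measurable_fst, lintegral_map hcpm measurable_snd]
        _ ≤ 2 * ENNReal.ofReal C := by
            simp only [hcpow]
            rw [two_mul (ENNReal.ofReal C)]; exact add_le_add hPC hQC
    have hmain : ∫⁻ q, edist q.1 q.2 ^ p ∂(π.map (fun q : X × X => (T q.1, T q.2))) ≤
        (2 * ENNReal.ofReal C) ^ (1 / (2:ℝ)) *
          (∫⁻ q, edist q.1 q.2 ^ (2 * β * p) ∂π) ^ (1 / (2:ℝ)) := by
      calc _ ≤ ∫⁻ q, edist (T q.1) (T q.2) ^ p ∂π := lintegral_map_le _ _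
        _ ≤ ∫⁻ q, F q ^ p * (edist q.1 q.2 ^ (β * p)) ∂π := by
            apply lintegral_mono
            intro q
            dsimp only
            rw [ENNReal.rpow_mul, ← ENNReal.mul_rpow_of_nonneg _ _ hp0.le]
            exact ENNReal.rpow_le_rpow (hpt q) hp0.le
        _ ≤ _ := lintegral_mul_le_sq_aux π _ _ (hFm.pow_const _)
            (fun q => ENNReal.rpow_ne_top_of_nonneg hp0.le (hFt q))
        _ ≤ _ := by
            simp only [← ENNReal.rpow_mul]
            rw [show p * 2 = 2 * p by ring, show β * p * 2 = 2 * β * p by ring]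
            gcongr
    refine hle.trans ((ENNReal.rpow_le_rpow hmain (by positivity)).trans ?_)
    rw [ENNReal.mul_rpow_of_nonneg _ _ (by positivity)]
    simp only [← ENNReal.rpow_mul]
    rw [show 1 / (2 * β * p) * β = 1 / 2 * (1 / p) by field_simp]
    gcongr
    rw [hK, show (1:ℝ) / 2 * (1 / p) = 1 / (2 * p) by field_simp,
      ENNReal.mul_rpow_of_nonneg _ _ (by positivity), ENNReal.ofReal_mul (by norm_num),
      ← ENNReal.ofReal_rpow_of_nonneg hC (by positivity)]
    gcongr
    rw [show ENNReal.ofReal 2 = 2 by simp]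
    calc (2:ℝ≥0∞) ^ (1 / (2 * p)) ≤ 2 ^ (1:ℝ) := by
          apply ENNReal.rpow_le_rpow_of_exponent_le (by norm_num)
          rw [div_le_one (by positivity)]; linarith
      _ = 2 := by simp
  -- pass to the infimum
  by_cases hK0 : K = 0
  · have := key (P.prod Q) (by simp) (by simp)
    rw [hK0, zero_mul] at this
    exact this.trans zero_le
  · have hKt : K ≠ ⊤ := ENNReal.ofReal_ne_top
    rw [mul_comm, ← ENNReal.div_le_iff hK0 hKt, ← ENNReal.rpow_inv_le_iff hβ0]
    refine le_iInf₂ fun π hπ => ?_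
    rw [ENNReal.rpow_inv_le_iff hβ0, ENNReal.div_le_iff hK0 hKt, mul_comm]
    exact key π hπ.1 hπ.2
end

section
/- Let (X, d_X) be a metric space with Borel σ-algebra, β ∈ (0,1], and let π be a probability measure on X × X whose coordinate marginals are P and Q. Let A be a nonempty set of measurable functions Z : X × X → [0,∞) with ∫ Z dπ = 1, and let f : X → ℝ be β-Hölder with constant C. Assume that for every Z ∈ A the functions (x,y) ↦ Z(x,y)·f(x), (x,y) ↦ Z(x,y)·f(y), and (x,y) ↦ Z(x,y)·d_X(x,y)^β are π-integrable, and that the three suprema Risk_P(f) := sup_{Z∈A} ∫ Z(x,y) f(x) dπ, Risk_Q(f) := sup_{Z∈A} ∫ Z(x,y) f(y) dπ, and R := sup_{Z∈A} ∫ Z(x,y) d_X(x,y)^β dπ are finite. Then Risk_P(f) − Risk_Q(f) ≤ C · R. -/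
open MeasureTheory

/-- one-sided risk-functional sensitivity bound. For a coupling `π` of
`P` and `Q`, a support set `A` of nonnegative densities on the product space, and a
`β`-Hölder function `f` with constant `C`,
`Risk_P(f) - Risk_Q(f) ≤ C · sup_{Z∈A} ∫ Z(x,y) d(x,y)^β dπ`. -/
theorem risk_sensitivity_one_sided {X : Type*} [MetricSpace X] [MeasurableSpace X]
    [BorelSpace X]
    (β C : ℝ) (hβ0 : 0 < β) (hβ1 : β ≤ 1) (hC : 0 ≤ C)
    (π : Measure (X × X)) [IsProbabilityMeasure π]
    (P Q : Measure X) (hπ1 : π.map Prod.fst = P) (hπ2 : π.map Prod.snd = Q)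
    (A : Set (X × X → ℝ)) (hA : A.Nonempty)
    (hAZ : ∀ Z ∈ A, Measurable Z ∧ (∀ q, 0 ≤ Z q) ∧ ∫ q, Z q ∂π = 1)
    (f : X → ℝ) (hf : ∀ x y : X, |f x - f y| ≤ C * dist x y ^ β)
    (hint : ∀ Z ∈ A,
      Integrable (fun q : X × X => Z q * f q.1) π ∧
      Integrable (fun q : X × X => Z q * f q.2) π ∧
      Integrable (fun q : X × X => Z q * dist q.1 q.2 ^ β) π)
    (hb1 : BddAbove ((fun Z : X × X → ℝ => ∫ q, Z q * f q.1 ∂π) '' A))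
    (hb2 : BddAbove ((fun Z : X × X → ℝ => ∫ q, Z q * f q.2 ∂π) '' A))
    (hb3 : BddAbove ((fun Z : X × X → ℝ => ∫ q, Z q * dist q.1 q.2 ^ β ∂π) '' A)) :
    sSup ((fun Z : X × X → ℝ => ∫ q, Z q * f q.1 ∂π) '' A)
      - sSup ((fun Z : X × X → ℝ => ∫ q, Z q * f q.2 ∂π) '' A)
      ≤ C * sSup ((fun Z : X × X → ℝ => ∫ q, Z q * dist q.1 q.2 ^ β ∂π) '' A) := by
  rw [sub_le_iff_le_add]
  apply csSup_le (hA.image _)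
  rintro _ ⟨Z, hZ, rfl⟩
  obtain ⟨h1, h2, h3⟩ := hint Z hZ
  have e2 := le_csSup hb2 (Set.mem_image_of_mem _ hZ)
  have e3 := mul_le_mul_of_nonneg_left (le_csSup hb3 (Set.mem_image_of_mem _ hZ)) hC
  refine le_trans ?_ (add_le_add e3 e2)
  show ∫ q, Z q * f q.1 ∂π ≤ C * ∫ q, Z q * dist q.1 q.2 ^ β ∂π + ∫ q, Z q * f q.2 ∂π
  rw [← integral_const_mul, ← integral_add (h3.const_mul C) h2]
  refine integral_mono h1 ((h3.const_mul C).add h2) fun q => ?_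
  show Z q * f q.1 ≤ C * (Z q * dist q.1 q.2 ^ β) + Z q * f q.2
  have h := mul_le_mul_of_nonneg_left ((le_abs_self _).trans (hf q.1 q.2)) ((hAZ Z hZ).2.1 q)
  linarith
end

section
/- Let (X, d_X) be a metric space with Borel σ-algebra, β ∈ (0,1], p ≥ 1 with p > β, and set p_β := p/(p−β). Let π be a probability measure on X × X whose coordinate marginals are P and Q, and let A be a nonempty set of measurable functions Z : X × X → [0,∞) with ∫ Z dπ = 1. Let f : X → ℝ be β-Hölder with constant C. Assume that (x,y) ↦ |f(x)|^{p/β} and (x,y) ↦ |f(y)|^{p/β} are π-integrable, that ∫ d_X(x,y)^p dπ < ∞, and that every Z ∈ A lies in L^{p_β}(π) with K := sup_{Z∈A} ( ∫ Z^{p_β} dπ )^{1/p_β} < ∞. Then | Risk_P(f) − Risk_Q(f) | ≤ C · K · ( ∫∫ d_X(x,y)^p dπ(x,y) )^{β/p}. -/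
open MeasureTheory

lemma memLp_aux {Ω : Type*} [MeasurableSpace Ω] {μ : Measure Ω} {g : Ω → ℝ} {r : ℝ} (hr : 0 < r)
    (hg : AEStronglyMeasurable g μ) (hi : Integrable (fun q => |g q| ^ r) μ) :
    MemLp g (ENNReal.ofReal r) μ := by
  rw [← integrable_norm_rpow_iff hg (by simpa using hr) (by simp)]
  simpa [ENNReal.toReal_ofReal hr.le] using hi

lemma sSup_image_aux {α : Type*} {A : Set α} (hA : A.Nonempty) {F G : α → ℝ} {B : ℝ}
    (hG : BddAbove (G '' A)) (h : ∀ a ∈ A, F a ≤ G a + B) :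
    sSup (F '' A) - sSup (G '' A) ≤ B := by
  have : sSup (F '' A) ≤ sSup (G '' A) + B := by
    apply csSup_le (hA.image F)
    rintro _ ⟨a, ha, rfl⟩
    have := le_csSup hG (Set.mem_image_of_mem G ha)
    linarith [h a ha]
  linarith

/-- risk-functional sensitivity bound via Hölder's inequality. For a
coupling `π` of `P` and `Q`, a support set `A` of nonnegative densities with
`L^{p_β}(π)` norms bounded by `K` (where `p_β = p/(p-β)`), and a `β`-Hölder function
`f` with constant `C`,
`|Risk_P(f) - Risk_Q(f)| ≤ C · K · (∫∫ d(x,y)^p dπ)^{β/p}`. -/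
theorem risk_sensitivity_holder {X : Type*} [MetricSpace X] [MeasurableSpace X]
    [BorelSpace X]
    (β p C K : ℝ) (hβ0 : 0 < β) (hβ1 : β ≤ 1) (hp : 1 ≤ p) (hβp : β < p) (hC : 0 ≤ C)
    (π : Measure (X × X)) [IsProbabilityMeasure π]
    (P Q : Measure X) (hπ1 : π.map Prod.fst = P) (hπ2 : π.map Prod.snd = Q)
    (A : Set (X × X → ℝ)) (hA : A.Nonempty)
    (hAZ : ∀ Z ∈ A, Measurable Z ∧ (∀ q, 0 ≤ Z q) ∧ ∫ q, Z q ∂π = 1)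
    (f : X → ℝ) (hf : ∀ x y : X, |f x - f y| ≤ C * dist x y ^ β)
    (hf1 : Integrable (fun q : X × X => |f q.1| ^ (p / β)) π)
    (hf2 : Integrable (fun q : X × X => |f q.2| ^ (p / β)) π)
    (hd : Integrable (fun q : X × X => dist q.1 q.2 ^ p) π)
    (hZLp : ∀ Z ∈ A, Integrable (fun q : X × X => Z q ^ (p / (p - β))) π)
    (hK : ∀ Z ∈ A, (∫ q, Z q ^ (p / (p - β)) ∂π) ^ ((p - β) / p) ≤ K) :
    |sSup ((fun Z : X × X → ℝ => ∫ q, Z q * f q.1 ∂π) '' A)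
        - sSup ((fun Z : X × X → ℝ => ∫ q, Z q * f q.2 ∂π) '' A)|
      ≤ C * K * (∫ q, dist q.1 q.2 ^ p ∂π) ^ (β / p) := by
  have hp0 : 0 < p := by linarith
  have hpb : 0 < p - β := by linarith
  have hconj : (p / (p - β)).HolderConjugate (p / β) := by
    rw [Real.holderConjugate_iff]
    refine ⟨by rw [lt_div_iff₀ hpb]; linarith, ?_⟩
    field_simp
    ring
  have hr0 : 0 < p / β := by positivity
  have hs0 : 0 < p / (p - β) := by positivity
  haveI : ENNReal.HolderConjugate (ENNReal.ofReal (p / (p - β))) (ENNReal.ofReal (p / β)) :=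
    hconj.ennrealOfReal
  have hZm : ∀ Z ∈ A, MemLp Z (ENNReal.ofReal (p / (p - β))) π := by
    intro Z hZ
    obtain ⟨h1, h2, -⟩ := hAZ Z hZ
    refine memLp_aux hs0 h1.aestronglyMeasurable ?_
    simpa only [abs_of_nonneg (h2 _)] using hZLp Z hZ
  -- Hölder with the constant `K`
  have key : ∀ Z ∈ A, ∀ g : X × X → ℝ, (∀ q, 0 ≤ g q) →
      MemLp g (ENNReal.ofReal (p / β)) π →
      ∫ q, Z q * g q ∂π ≤ K * (∫ q, g q ^ (p / β) ∂π) ^ (β / p) := by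
    intro Z hZ g hg0 hg
    have h := integral_mul_le_Lp_mul_Lq_of_nonneg hconj
      (Filter.Eventually.of_forall (hAZ Z hZ).2.1) (Filter.Eventually.of_forall hg0) (hZm Z hZ) hg
    rw [one_div_div, one_div_div] at h
    refine h.trans (mul_le_mul_of_nonneg_right (hK Z hZ) ?_)
    exact Real.rpow_nonneg (integral_nonneg fun q => Real.rpow_nonneg (hg0 q) _) _
  have hfc : Continuous f := by
    rw [continuous_iff_continuousAt]
    intro x
    rw [ContinuousAt, tendsto_iff_dist_tendsto_zero]
    have hlim : Filter.Tendsto (fun y => C * dist y x ^ β) (nhds x) (nhds 0) := by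
      have hc : Continuous (fun y => C * dist y x ^ β) :=
        continuous_const.mul ((continuous_id.dist continuous_const).rpow_const
          fun _ => Or.inr hβ0.le)
      have := hc.tendsto x
      simpa [Real.zero_rpow hβ0.ne'] using this
    exact squeeze_zero (fun _ => dist_nonneg) (fun y => hf y x) hlim
  have hfm : Measurable f := hfc.measurable
  have hm1 : MemLp (fun q : X × X => f q.1) (ENNReal.ofReal (p / β)) π :=
    memLp_aux hr0 (hfm.comp measurable_fst).aestronglyMeasurable hf1
  have hm2 : MemLp (fun q : X × X => f q.2) (ENNReal.ofReal (p / β)) π :=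
    memLp_aux hr0 (hfm.comp measurable_snd).aestronglyMeasurable hf2
  have hdp : ∀ q : X × X, (dist q.1 q.2 ^ β) ^ (p / β) = dist q.1 q.2 ^ p := by
    intro q
    rw [← Real.rpow_mul dist_nonneg]
    congr 1
    field_simp
  have hdm : MemLp (fun q : X × X => dist q.1 q.2 ^ β) (ENNReal.ofReal (p / β)) π := by
    refine memLp_aux hr0 ?_ ?_
    · have h1 : AEMeasurable (fun q : X × X => (dist q.1 q.2 ^ p) ^ (β / p)) π :=
        hd.aemeasurable.pow_const _
      refine (h1.congr (Filter.Eventually.of_forall fun q => ?_)).aestronglyMeasurable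
      simp only
      rw [← Real.rpow_mul dist_nonneg]
      congr 1
      field_simp
    · simpa only [abs_of_nonneg (Real.rpow_nonneg dist_nonneg β), hdp] using hd
  have hint : ∀ Z ∈ A, ∀ g : X × X → ℝ, MemLp g (ENNReal.ofReal (p / β)) π →
      Integrable (fun q => Z q * g q) π := fun Z hZ g hg => (hZm Z hZ).integrable_mul hg
  have hbdd : ∀ g : X × X → ℝ, MemLp g (ENNReal.ofReal (p / β)) π →
      BddAbove ((fun Z : X × X → ℝ => ∫ q, Z q * g q ∂π) '' A) := by
    intro g hg
    refine ⟨K * (∫ q, |g q| ^ (p / β) ∂π) ^ (β / p), ?_⟩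
    rintro _ ⟨Z, hZ, rfl⟩
    refine le_trans ?_ (key Z hZ (fun q => |g q|) (fun q => abs_nonneg _) hg.norm)
    exact integral_mono (hint Z hZ g hg) (hint Z hZ _ hg.norm) fun q =>
      mul_le_mul_of_nonneg_left (le_abs_self _) ((hAZ Z hZ).2.1 q)
  have hdiff : ∀ Z ∈ A, |∫ q, Z q * f q.1 ∂π - ∫ q, Z q * f q.2 ∂π|
      ≤ C * K * (∫ q, dist q.1 q.2 ^ p ∂π) ^ (β / p) := by
    intro Z hZ
    have h0 := key Z hZ _ (fun q => Real.rpow_nonneg dist_nonneg β) hdm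
    simp only [hdp] at h0
    rw [← integral_sub (hint Z hZ _ hm1) (hint Z hZ _ hm2)]
    calc |∫ q, (Z q * f q.1 - Z q * f q.2) ∂π|
        ≤ ∫ q, C * (Z q * dist q.1 q.2 ^ β) ∂π := by
          rw [← Real.norm_eq_abs]
          refine norm_integral_le_of_norm_le ((hint Z hZ _ hdm).const_mul C)
            (Filter.Eventually.of_forall fun q => ?_)
          have hz := (hAZ Z hZ).2.1 q
          rw [← mul_sub, Real.norm_eq_abs, abs_mul, abs_of_nonneg hz]
          calc Z q * |f q.1 - f q.2| ≤ Z q * (C * dist q.1 q.2 ^ β) :=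
                mul_le_mul_of_nonneg_left (hf _ _) hz
            _ = _ := by ring
      _ = C * ∫ q, Z q * dist q.1 q.2 ^ β ∂π := integral_const_mul _ _
      _ ≤ C * (K * (∫ q, dist q.1 q.2 ^ p ∂π) ^ (β / p)) := mul_le_mul_of_nonneg_left h0 hC
      _ = _ := by ring
  rw [abs_sub_le_iff]
  constructor
  · refine sSup_image_aux hA (hbdd _ hm2) fun Z hZ => ?_
    linarith [(abs_le.1 (hdiff Z hZ)).2]
  · refine sSup_image_aux hA (hbdd _ hm1) fun Z hZ => ?_
    linarith [(abs_le.1 (hdiff Z hZ)).1]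
end

section
/- Let (X, d_X) be a metric space with Borel σ-algebra, β ∈ (0,1], p ≥ 1 with p > β, and set p_β := p/(p−β). Let P and Q be Borel probability measures on X and let π be a coupling of P and Q that attains the p-Wasserstein distance, i.e. ( ∫∫ d_X(x,y)^p dπ )^{1/p} = d_p(P,Q) < ∞. Let A be a nonempty set of measurable functions Z : X × X → [0,∞) with ∫ Z dπ = 1, let f : X → ℝ be β-Hölder with constant C, assume (x,y) ↦ |f(x)|^{p/β} and (x,y) ↦ |f(y)|^{p/β} are π-integrable, and assume every Z ∈ A lies in L^{p_β}(π) with K := sup_{Z∈A} ( ∫ Z^{p_β} dπ )^{1/p_β} < ∞. Then | Risk_P(f) − Risk_Q(f) | ≤ C · K · d_p(P, Q)^β. -/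
open MeasureTheory
open scoped ENNReal

theorem risk_aux_memLp {Y : Type*} [MeasurableSpace Y] (μ : Measure Y) (s : ℝ) (hs : 0 < s)
    (g : Y → ℝ) (hg : AEStronglyMeasurable g μ) (hi : Integrable (fun q => |g q| ^ s) μ) :
    MemLp g (ENNReal.ofReal s) μ := by
  have h := integrable_norm_rpow_iff (μ := μ) (f := g) (p := ENNReal.ofReal s) hg
    (by simpa using hs) ENNReal.ofReal_ne_top
  rw [ENNReal.toReal_ofReal hs.le] at h
  exact h.1 (by simpa [Real.norm_eq_abs] using hi)

theorem risk_aux_holder {Y : Type*} [MeasurableSpace Y] (μ : Measure Y) (t s K : ℝ)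
    (hts : t.HolderConjugate s) (Z g : Y → ℝ) (hZ0 : ∀ q, 0 ≤ Z q)
    (hZ : MemLp Z (ENNReal.ofReal t) μ) (hg : MemLp g (ENNReal.ofReal s) μ)
    (hK : (∫ q, Z q ^ t ∂μ) ^ (1 / t) ≤ K) :
    Integrable (fun q => Z q * g q) μ ∧
      |∫ q, Z q * g q ∂μ| ≤ K * (∫ q, |g q| ^ s ∂μ) ^ (1 / s) := by
  have : (ENNReal.ofReal t).HolderConjugate (ENNReal.ofReal s) := hts.ennrealOfReal
  refine ⟨hZ.integrable_mul hg, ?_⟩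
  calc |∫ q, Z q * g q ∂μ| ≤ ∫ q, |Z q * g q| ∂μ := abs_integral_le_integral_abs
    _ = ∫ q, Z q * |g q| ∂μ := by
        congr 1; ext q; rw [abs_mul, abs_of_nonneg (hZ0 q)]
    _ ≤ (∫ q, Z q ^ t ∂μ) ^ (1 / t) * (∫ q, |g q| ^ s ∂μ) ^ (1 / s) :=
        integral_mul_le_Lp_mul_Lq_of_nonneg hts (Filter.Eventually.of_forall hZ0)
          (Filter.Eventually.of_forall fun q => abs_nonneg _) hZ hg.abs
    _ ≤ _ := by
        gcongr

/-- risk-functional sensitivity in Wasserstein distance. If `π` is an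
optimal coupling attaining the finite `p`-Wasserstein distance of `P` and `Q`, `A`
is a support set of nonnegative densities with `L^{p_β}(π)` norms bounded by `K`
(where `p_β = p/(p-β)`), and `f` is `β`-Hölder with constant `C`, then
`|Risk_P(f) - Risk_Q(f)| ≤ C · K · d_p(P,Q)^β`. -/
theorem risk_sensitivity_wasserstein {X : Type*} [MetricSpace X] [MeasurableSpace X]
    [BorelSpace X]
    (β p C K : ℝ) (hβ0 : 0 < β) (hβ1 : β ≤ 1) (hp : 1 ≤ p) (hβp : β < p) (hC : 0 ≤ C)
    (P Q : Measure X) [IsProbabilityMeasure P] [IsProbabilityMeasure Q]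
    (π : Measure (X × X)) [IsProbabilityMeasure π]
    (hπ1 : π.map Prod.fst = P) (hπ2 : π.map Prod.snd = Q)
    (hfin : wassersteinDist p P Q < ⊤)
    (hopt : (∫⁻ q, edist q.1 q.2 ^ p ∂π) ^ (1 / p) = wassersteinDist p P Q)
    (A : Set (X × X → ℝ)) (hA : A.Nonempty)
    (hAZ : ∀ Z ∈ A, Measurable Z ∧ (∀ q, 0 ≤ Z q) ∧ ∫ q, Z q ∂π = 1)
    (f : X → ℝ) (hf : ∀ x y : X, |f x - f y| ≤ C * dist x y ^ β)
    (hf1 : Integrable (fun q : X × X => |f q.1| ^ (p / β)) π)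
    (hf2 : Integrable (fun q : X × X => |f q.2| ^ (p / β)) π)
    (hZLp : ∀ Z ∈ A, Integrable (fun q : X × X => Z q ^ (p / (p - β))) π)
    (hK : ∀ Z ∈ A, (∫ q, Z q ^ (p / (p - β)) ∂π) ^ ((p - β) / p) ≤ K) :
    |sSup ((fun Z : X × X → ℝ => ∫ q, Z q * f q.1 ∂π) '' A)
        - sSup ((fun Z : X × X → ℝ => ∫ q, Z q * f q.2 ∂π) '' A)|
      ≤ C * K * (wassersteinDist p P Q).toReal ^ β := by
  have hp0 : 0 < p := by linarith
  have hpb : 0 < p - β := by linarith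
  have hs : 0 < p / β := by positivity
  have hts : (p / (p - β)).HolderConjugate (p / β) := by
    rw [Real.holderConjugate_iff]
    refine ⟨by rw [lt_div_iff₀ hpb]; linarith, ?_⟩
    field_simp
    ring
  have hfc : Continuous f := by
    rw [continuous_iff_continuousAt]
    intro x
    rw [ContinuousAt, tendsto_iff_dist_tendsto_zero]
    have h1 : Filter.Tendsto (fun y => C * dist y x ^ β) (nhds x) (nhds 0) := by
      have h2 : Continuous (fun y => C * dist y x ^ β) :=
        continuous_const.mul ((continuous_id.dist continuous_const).rpow_const
          (fun _ => Or.inr hβ0.le))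
      have h3 := h2.tendsto x
      simpa [Real.zero_rpow hβ0.ne'] using h3
    exact squeeze_zero (fun _ => dist_nonneg) (fun y => by
      rw [Real.dist_eq]; exact hf y x) h1
  have hfm : Measurable f := hfc.measurable
  have m1 := risk_aux_memLp π (p / β) hs (fun q : X × X => f q.1)
    (hfm.comp measurable_fst).aestronglyMeasurable hf1
  have m2 := risk_aux_memLp π (p / β) hs (fun q : X × X => f q.2)
    (hfm.comp measurable_snd).aestronglyMeasurable hf2
  have m3 : MemLp (fun q : X × X => f q.1 - f q.2) (ENNReal.ofReal (p / β)) π := m1.sub m2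
  have mZ : ∀ Z ∈ A, MemLp Z (ENNReal.ofReal (p / (p - β))) π := fun Z hZ =>
    risk_aux_memLp π _ hts.pos Z (hAZ Z hZ).1.aestronglyMeasurable
      ((hZLp Z hZ).congr (Filter.Eventually.of_forall fun q => by
        simp only [abs_of_nonneg ((hAZ Z hZ).2.1 q)]))
  have hK' : ∀ Z ∈ A, (∫ q, Z q ^ (p / (p - β)) ∂π) ^ (1 / (p / (p - β))) ≤ K := by
    intro Z hZ
    rw [one_div_div]; exact hK Z hZ
  have hK0 : 0 ≤ K := by
    obtain ⟨Z, hZ⟩ := hA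
    refine le_trans (Real.rpow_nonneg (integral_nonneg fun q => ?_) _) (hK Z hZ)
    exact Real.rpow_nonneg ((hAZ Z hZ).2.1 q) _
  have H1 := fun Z hZ => risk_aux_holder π _ _ K hts Z _ (hAZ Z hZ).2.1 (mZ Z hZ) m1 (hK' Z hZ)
  have H2 := fun Z hZ => risk_aux_holder π _ _ K hts Z _ (hAZ Z hZ).2.1 (mZ Z hZ) m2 (hK' Z hZ)
  have H3 := fun Z hZ => risk_aux_holder π _ _ K hts Z _ (hAZ Z hZ).2.1 (mZ Z hZ) m3 (hK' Z hZ)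
  -- the `L^{p/β}` norm of the difference
  have key : (∫ q : X × X, |f q.1 - f q.2| ^ (p / β) ∂π) ^ (1 / (p / β))
      ≤ C * (wassersteinDist p P Q).toReal ^ β := by
    have hI : (∫⁻ q, edist q.1 q.2 ^ p ∂π) ≠ ⊤ := by
      intro h
      rw [h, ENNReal.top_rpow_of_pos (by positivity)] at hopt
      exact hfin.ne hopt.symm
    have hle : (∫ q : X × X, |f q.1 - f q.2| ^ (p / β) ∂π)
        ≤ C ^ (p / β) * (∫⁻ q, edist q.1 q.2 ^ p ∂π).toReal := by
      have hmeas : AEStronglyMeasurable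
          (fun q : X × X => |f q.1 - f q.2| ^ (p / β)) π :=
        (((hfm.comp measurable_fst).sub (hfm.comp measurable_snd)).abs.pow_const
          (p / β)).aestronglyMeasurable
      rw [integral_eq_lintegral_of_nonneg_ae
        (Filter.Eventually.of_forall fun q => Real.rpow_nonneg (abs_nonneg _) _)
        hmeas]
      have : C ^ (p / β) = (ENNReal.ofReal (C ^ (p / β))).toReal :=
        (ENNReal.toReal_ofReal (by positivity)).symm
      rw [this, ← ENNReal.toReal_mul]
      refine ENNReal.toReal_mono (ENNReal.mul_ne_top ENNReal.ofReal_ne_top hI) ?_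
      rw [← lintegral_const_mul' _ _ ENNReal.ofReal_ne_top]
      refine lintegral_mono fun q => ?_
      rw [edist_dist, ENNReal.ofReal_rpow_of_nonneg dist_nonneg hp0.le,
        ← ENNReal.ofReal_mul (by positivity)]
      refine ENNReal.ofReal_le_ofReal ?_
      calc |f q.1 - f q.2| ^ (p / β) ≤ (C * dist q.1 q.2 ^ β) ^ (p / β) :=
            Real.rpow_le_rpow (abs_nonneg _) (hf _ _) hs.le
        _ = C ^ (p / β) * dist q.1 q.2 ^ p := by
            rw [Real.mul_rpow hC (by positivity), ← Real.rpow_mul dist_nonneg]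
            congr 2
            field_simp
    have h0 : 0 ≤ ∫ q : X × X, |f q.1 - f q.2| ^ (p / β) ∂π :=
      integral_nonneg fun q => Real.rpow_nonneg (abs_nonneg _) _
    refine (Real.rpow_le_rpow h0 hle (by positivity)).trans (le_of_eq ?_)
    rw [Real.mul_rpow (by positivity) ENNReal.toReal_nonneg, ← Real.rpow_mul hC, ← hopt,
      ← ENNReal.toReal_rpow, ← Real.rpow_mul ENNReal.toReal_nonneg,
      mul_one_div_cancel hs.ne', Real.rpow_one]
    congr 2
    field_simp
  have D : ∀ Z ∈ A, |∫ q, Z q * f q.1 ∂π - ∫ q, Z q * f q.2 ∂π|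
      ≤ C * K * (wassersteinDist p P Q).toReal ^ β := by
    intro Z hZ
    rw [← integral_sub (H1 Z hZ).1 (H2 Z hZ).1]
    have h := (H3 Z hZ).2.trans (mul_le_mul_of_nonneg_left key hK0)
    simp only [mul_sub] at h
    refine h.trans (le_of_eq ?_)
    ring
  have B1 : BddAbove ((fun Z : X × X → ℝ => ∫ q, Z q * f q.1 ∂π) '' A) := by
    refine ⟨K * (∫ q : X × X, |f q.1| ^ (p / β) ∂π) ^ (1 / (p / β)), ?_⟩
    · rintro _ ⟨Z, hZ, rfl⟩
      exact (le_abs_self _).trans (H1 Z hZ).2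
  have B2 : BddAbove ((fun Z : X × X → ℝ => ∫ q, Z q * f q.2 ∂π) '' A) := by
    refine ⟨K * (∫ q : X × X, |f q.2| ^ (p / β) ∂π) ^ (1 / (p / β)), ?_⟩
    · rintro _ ⟨Z, hZ, rfl⟩
      exact (le_abs_self _).trans (H2 Z hZ).2
  rw [abs_sub_le_iff]
  constructor
  · rw [sub_le_iff_le_add]
    refine csSup_le (hA.image _) ?_
    rintro _ ⟨Z, hZ, rfl⟩
    have h1 := (abs_sub_le_iff.1 (D Z hZ)).1
    have h2 := le_csSup B2 (Set.mem_image_of_mem _ hZ)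
    simp only at h2 ⊢
    linarith
  · rw [sub_le_iff_le_add]
    refine csSup_le (hA.image _) ?_
    rintro _ ⟨Z, hZ, rfl⟩
    have h1 := (abs_sub_le_iff.1 (D Z hZ)).2
    have h2 := le_csSup B1 (Set.mem_image_of_mem _ hZ)
    simp only at h2 ⊢
    linarith
end

section
/- Let (X, d_X) and (U, d_U) be metric spaces with Borel σ-algebras, β ∈ (0,1], p ≥ 1, α ∈ [0,1). Let S : X → U be Borel measurable and β-Hölder with constant C_S, let φ : U → ℝ be Lipschitz with constant C_φ, and let P, Q ∈ P_p(X) be Borel probability measures. Then φ∘S is integrable with respect to both P and Q, and | AVaR_{α,P}(φ∘S) − AVaR_{α,Q}(φ∘S) | ≤ (1−α)^{-1} · C_φ · C_S · d_p(P, Q)^β. -/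
open MeasureTheory
open scoped ENNReal

/-- The average value-at-risk at level `α` of `g` under `μ`:
`AVaR_{α,μ}(g) = inf_q ( q + (1-α)⁻¹ ∫ max (g - q) 0 dμ )`. -/
noncomputable def avar {Ω : Type*} [MeasurableSpace Ω] (α : ℝ) (μ : Measure Ω)
    (g : Ω → ℝ) : ℝ :=
  ⨅ q : ℝ, q + (1 - α)⁻¹ * ∫ ω, max (g ω - q) 0 ∂μ

theorem aux_jensen {Ω : Type*} [MeasurableSpace Ω] (μ : Measure Ω) [IsProbabilityMeasure μ]
    (β p K : ℝ) (hβ0 : 0 < β) (hβ1 : β ≤ 1) (hp : 1 ≤ p)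
    (h : Ω → ℝ) (hm : Measurable h) (e : Ω → ℝ≥0∞)
    (hle : ∀ ω, ‖h ω‖ₑ ≤ ENNReal.ofReal K * e ω ^ β) :
    ∫⁻ ω, ‖h ω‖ₑ ∂μ ≤ ENNReal.ofReal K * ((∫⁻ ω, e ω ^ p ∂μ) ^ (1 / p)) ^ β := by
  have hp0 : 0 < p := by linarith
  have hr : 1 ≤ p / β := by rw [le_div_iff₀ hβ0]; linarith
  have hr0 : 0 < p / β := by linarith
  have h1 := eLpNorm'_le_eLpNorm'_of_exponent_le (μ := μ) (f := h) (p := 1) (q := p / β)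
    zero_lt_one hr hm.aestronglyMeasurable
  simp only [eLpNorm'_eq_lintegral_enorm, ENNReal.rpow_one, div_one] at h1
  refine h1.trans ?_
  have h2 : ∫⁻ ω, ‖h ω‖ₑ ^ (p / β) ∂μ ≤ ENNReal.ofReal K ^ (p / β) * ∫⁻ ω, e ω ^ p ∂μ := by
    rw [← lintegral_const_mul' _ _ (ENNReal.rpow_ne_top_of_nonneg hr0.le ENNReal.ofReal_ne_top)]
    refine lintegral_mono fun ω => ?_
    calc ‖h ω‖ₑ ^ (p / β) ≤ (ENNReal.ofReal K * e ω ^ β) ^ (p / β) :=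
          ENNReal.rpow_le_rpow (hle ω) hr0.le
      _ = _ := by
          rw [ENNReal.mul_rpow_of_nonneg _ _ hr0.le, ← ENNReal.rpow_mul]
          congr 2
          field_simp
  calc _ ≤ (ENNReal.ofReal K ^ (p / β) * ∫⁻ ω, e ω ^ p ∂μ) ^ (1 / (p / β)) :=
        ENNReal.rpow_le_rpow h2 (by positivity)
    _ = _ := by
        rw [ENNReal.mul_rpow_of_nonneg _ _ (by positivity), ← ENNReal.rpow_mul,
          ← ENNReal.rpow_mul, mul_one_div_cancel hr0.ne', ENNReal.rpow_one]
        congr 2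
        field_simp

theorem aux_integrable {X : Type*} [MetricSpace X] [MeasurableSpace X] [BorelSpace X]
    (β p K : ℝ) (hβ0 : 0 < β) (hβ1 : β ≤ 1) (hp : 1 ≤ p)
    (g : X → ℝ) (hg : Measurable g)
    (hle : ∀ x y, ‖g x - g y‖ₑ ≤ ENNReal.ofReal K * edist x y ^ β)
    (P : Measure X) [IsProbabilityMeasure P] (hP : memWassersteinSpace p P) :
    Integrable g P := by
  obtain ⟨x₀, hx⟩ := hP
  have h1 := aux_jensen P β p K hβ0 hβ1 hp (fun x => g x - g x₀) (hg.sub_const _)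
    (fun x => edist x x₀) (fun x => hle x x₀)
  have h2 : Integrable (fun x => g x - g x₀) P := by
    refine ⟨(hg.sub_const _).aestronglyMeasurable, lt_of_le_of_lt h1 ?_⟩
    refine ENNReal.mul_lt_top ENNReal.ofReal_lt_top ?_
    refine ENNReal.rpow_lt_top_of_nonneg hβ0.le ?_
    exact ENNReal.rpow_ne_top_of_nonneg (by positivity) hx.ne
  have h3 := h2.add (integrable_const (g x₀))
  refine h3.congr (Filter.Eventually.of_forall fun x => ?_)
  simp

theorem aux_avar_le {X : Type*} [MeasurableSpace X] (α D : ℝ) (hα0 : 0 ≤ α) (hα1 : α < 1)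
    (g : X → ℝ) (P Q : Measure X) [IsProbabilityMeasure P]
    (hP : Integrable g P)
    (hD : ∀ q : ℝ, ∫ x, max (g x - q) 0 ∂P ≤ ∫ x, max (g x - q) 0 ∂Q + D) :
    avar α P g ≤ avar α Q g + (1 - α)⁻¹ * D := by
  have hc : 1 ≤ (1 - α)⁻¹ := (one_le_inv₀ (by linarith)).2 (by linarith)
  have hb : BddBelow (Set.range fun q : ℝ => q + (1 - α)⁻¹ * ∫ ω, max (g ω - q) 0 ∂P) := by
    refine ⟨∫ x, g x ∂P, ?_⟩
    rintro _ ⟨q, rfl⟩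
    have hi : Integrable (fun x => g x - q) P := hP.sub (integrable_const q)
    have h0 : 0 ≤ ∫ ω, max (g ω - q) 0 ∂P := integral_nonneg fun x => le_max_right _ _
    have h1 : ∫ x, (g x - q) ∂P ≤ ∫ ω, max (g ω - q) 0 ∂P :=
      integral_mono hi hi.pos_part fun x => le_max_left _ _
    rw [integral_sub hP (integrable_const q)] at h1
    simp at h1
    simp only
    nlinarith
  rw [← sub_le_iff_le_add]
  refine le_ciInf fun q => ?_
  rw [sub_le_iff_le_add]
  refine (ciInf_le hb q).trans ?_
  have := mul_le_mul_of_nonneg_left (hD q) (zero_le_one.trans hc)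
  linarith

theorem aux_coupling {X : Type*} [MeasurableSpace X]
    (g : X → ℝ) (hg : Measurable g) (P Q : Measure X)
    (hP : Integrable g P) (hQ : Integrable g Q) [IsProbabilityMeasure P] [IsProbabilityMeasure Q]
    (π : Measure (X × X)) (h1 : π.map Prod.fst = P) (h2 : π.map Prod.snd = Q) (q : ℝ) :
    |∫ x, max (g x - q) 0 ∂P - ∫ x, max (g x - q) 0 ∂Q| ≤ ∫ z, |g z.1 - g z.2| ∂π := by
  have hiP : Integrable (fun x => max (g x - q) 0) P := (hP.sub (integrable_const q)).pos_part
  have hiQ : Integrable (fun x => max (g x - q) 0) Q := (hQ.sub (integrable_const q)).pos_part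
  have m : Measurable (fun x => max (g x - q) 0) := (hg.sub_const q).max measurable_const
  subst h1 h2
  rw [integral_map measurable_fst.aemeasurable m.aestronglyMeasurable,
    integral_map measurable_snd.aemeasurable m.aestronglyMeasurable]
  have i1 := hiP.comp_measurable measurable_fst
  have i2 := hiQ.comp_measurable measurable_snd
  have j1 := hP.comp_measurable measurable_fst
  have j2 := hQ.comp_measurable measurable_snd
  have e := integral_sub i1 i2
  simp only [Function.comp_def] at e
  rw [← e]
  refine abs_integral_le_integral_abs.trans ?_
  refine integral_mono (i1.sub i2).abs (j1.sub j2).abs fun z => ?_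
  have := abs_max_sub_max_le_abs (g z.1 - q) (g z.2 - q) 0
  simpa using this

/-- for a measurable `β`-Hölder map `S` with constant `C_S`, a
Lipschitz quantity of interest `φ` with constant `C_φ`, and `P, Q ∈ P_p(X)`, the
composition `φ ∘ S` is integrable for both measures and
`|AVaR_{α,P}(φ∘S) - AVaR_{α,Q}(φ∘S)| ≤ (1-α)⁻¹ C_φ C_S d_p(P,Q)^β`. -/
theorem avar_sensitivity_holder {X U : Type*}
    [MetricSpace X] [MeasurableSpace X] [BorelSpace X]
    [MetricSpace U] [MeasurableSpace U] [BorelSpace U]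
    (β p α CS Cφ : ℝ) (hβ0 : 0 < β) (hβ1 : β ≤ 1) (hp : 1 ≤ p)
    (hα0 : 0 ≤ α) (hα1 : α < 1) (hCS : 0 ≤ CS) (hCφ : 0 ≤ Cφ)
    (S : X → U) (hSm : Measurable S)
    (hS : ∀ x y : X, dist (S x) (S y) ≤ CS * dist x y ^ β)
    (φ : U → ℝ) (hφ : ∀ u v : U, |φ u - φ v| ≤ Cφ * dist u v)
    (P Q : Measure X) [IsProbabilityMeasure P] [IsProbabilityMeasure Q]
    (hP : memWassersteinSpace p P) (hQ : memWassersteinSpace p Q) :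
    Integrable (fun x => φ (S x)) P ∧ Integrable (fun x => φ (S x)) Q ∧
    ENNReal.ofReal |avar α P (fun x => φ (S x)) - avar α Q (fun x => φ (S x))|
      ≤ ENNReal.ofReal ((1 - α)⁻¹ * Cφ * CS) * wassersteinDist p P Q ^ β := by
  have hc : 0 < (1 - α)⁻¹ := inv_pos.2 (by linarith)
  have hφm : Measurable φ := by
    have : LipschitzWith (Real.toNNReal Cφ) φ := LipschitzWith.of_dist_le_mul fun u v => by
      rw [Real.dist_eq, Real.coe_toNNReal _ hCφ]; exact hφ u v
    exact this.continuous.measurable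
  set g : X → ℝ := fun x => φ (S x) with hgdef
  have hg : Measurable g := hφm.comp hSm
  have hle : ∀ x y, ‖g x - g y‖ₑ ≤ ENNReal.ofReal (Cφ * CS) * edist x y ^ β := by
    intro x y
    rw [edist_dist, ENNReal.ofReal_rpow_of_nonneg dist_nonneg hβ0.le,
      ← ENNReal.ofReal_mul (by positivity), Real.enorm_eq_ofReal_abs]
    refine ENNReal.ofReal_le_ofReal ((hφ _ _).trans ?_)
    rw [mul_assoc]
    exact mul_le_mul_of_nonneg_left (hS x y) hCφ
  have iP : Integrable g P := aux_integrable β p _ hβ0 hβ1 hp g hg hle P hP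
  have iQ : Integrable g Q := aux_integrable β p _ hβ0 hβ1 hp g hg hle Q hQ
  refine ⟨iP, iQ, ?_⟩
  have key : ∀ π : Measure (X × X), π.map Prod.fst = P ∧ π.map Prod.snd = Q →
      ENNReal.ofReal |avar α P g - avar α Q g| ≤ ENNReal.ofReal ((1 - α)⁻¹ * Cφ * CS) *
        ((∫⁻ q, edist q.1 q.2 ^ p ∂π) ^ (1 / p)) ^ β := by
    rintro π ⟨h1, h2⟩
    have hπ : IsProbabilityMeasure π := by
      refine ⟨?_⟩
      have : (π.map Prod.fst) Set.univ = 1 := by rw [h1]; exact measure_univ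
      rwa [Measure.map_apply measurable_fst MeasurableSet.univ, Set.preimage_univ] at this
    have hc1 := aux_coupling g hg P Q iP iQ π h1 h2
    have m2 : Measurable (fun z : X × X => g z.1 - g z.2) :=
      (hg.comp measurable_fst).sub (hg.comp measurable_snd)
    set D := ∫ z, |g z.1 - g z.2| ∂π with hD
    have a1 := aux_avar_le α D hα0 hα1 g P Q iP fun q => by
      linarith [(abs_le.1 (hc1 q)).2]
    have a2 := aux_avar_le α D hα0 hα1 g Q P iQ fun q => by
      linarith [(abs_le.1 (hc1 q)).1]
    have a3 : |avar α P g - avar α Q g| ≤ (1 - α)⁻¹ * D :=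
      abs_le.2 ⟨by linarith, by linarith⟩
    refine (ENNReal.ofReal_le_ofReal a3).trans ?_
    rw [mul_assoc (1 - α)⁻¹, ENNReal.ofReal_mul hc.le, ENNReal.ofReal_mul hc.le, mul_assoc]
    refine mul_le_mul_right ?_ _
    refine le_trans ?_ (aux_jensen π β p _ hβ0 hβ1 hp (fun z => g z.1 - g z.2) m2
      (fun z => edist z.1 z.2) (fun z => hle z.1 z.2))
    have := enorm_integral_le_lintegral_enorm (μ := π) (fun z : X × X => |g z.1 - g z.2|)
    rw [← hD, Real.enorm_eq_ofReal (integral_nonneg fun z => abs_nonneg _)] at this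
    simpa [Real.enorm_abs] using this
  by_cases hK : ENNReal.ofReal ((1 - α)⁻¹ * Cφ * CS) = 0
  · have := key (P.prod Q) ⟨by simp [Measure.map_fst_prod], by simp [Measure.map_snd_prod]⟩
    rw [hK, zero_mul] at this ⊢
    exact this
  · rw [mul_comm, ← ENNReal.div_le_iff hK ENNReal.ofReal_ne_top, ← ENNReal.rpow_inv_le_iff hβ0]
    refine le_iInf₂ fun π hπ => ?_
    rw [ENNReal.rpow_inv_le_iff hβ0, ENNReal.div_le_iff hK ENNReal.ofReal_ne_top, mul_comm]
    exact key π hπ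
end

section
/- Let (X, d_X) and (U, d_U) be metric spaces with Borel σ-algebras, β ∈ (0,1], p ≥ 1, α ∈ [0,1). Let S : X → U be Borel measurable and locally β-Hölder with reference point x₀ ∈ X and nondecreasing function C_S : [0,∞) → [0,∞), let φ : U → ℝ be Lipschitz with constant C_φ, and let P, Q ∈ P_{2βp}(X) be Borel probability measures satisfying ∫ C_S(d_X(x,x₀))^{2p} dP(x) ≤ C and ∫ C_S(d_X(x,x₀))^{2p} dQ(x) ≤ C for a finite constant C. Assume φ∘S is integrable with respect to both P and Q. Then | AVaR_{α,P}(φ∘S) − AVaR_{α,Q}(φ∘S) | ≤ 2 · (1−α)^{-1} · C_φ · C^{1/(2p)} · d_{2p}(P, Q)^β. -/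
open MeasureTheory
open scoped ENNReal

lemma avar_aux_int {Ω : Type*} [MeasurableSpace Ω] (μ : Measure Ω) [IsProbabilityMeasure μ]
    (g : Ω → ℝ) (hg : Integrable g μ) (q : ℝ) : Integrable (fun x => max (g x - q) 0) μ :=
  (hg.sub (integrable_const q)).pos_part

lemma avar_aux_bdd {Ω : Type*} [MeasurableSpace Ω] (μ : Measure Ω) [IsProbabilityMeasure μ]
    (α : ℝ) (hα0 : 0 ≤ α) (hα1 : α < 1) (g : Ω → ℝ) (hg : Integrable g μ) :
    BddBelow (Set.range fun q : ℝ => q + (1 - α)⁻¹ * ∫ ω, max (g ω - q) 0 ∂μ) := by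
  refine ⟨∫ x, g x ∂μ, ?_⟩
  rintro _ ⟨q, rfl⟩
  have h1 : ∫ x, (g x - q) ∂μ ≤ ∫ ω, max (g ω - q) 0 ∂μ :=
    integral_mono (hg.sub (integrable_const q)) (avar_aux_int μ g hg q) (fun x => le_max_left _ _)
  have h0 : 0 ≤ ∫ ω, max (g ω - q) 0 ∂μ := integral_nonneg (fun x => le_max_right _ _)
  rw [integral_sub hg (integrable_const q)] at h1
  simp at h1
  have h2 : 1 ≤ (1 - α)⁻¹ := by
    rw [one_le_inv₀ (by linarith)]; linarith
  have h3 := mul_le_mul_of_nonneg_right h2 h0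
  simp only
  linarith

lemma avar_aux_le {Ω : Type*} [MeasurableSpace Ω] (π : Measure (Ω × Ω)) [IsProbabilityMeasure π]
    (P Q : Measure Ω) [IsProbabilityMeasure P] [IsProbabilityMeasure Q]
    (hP : π.map Prod.fst = P) (hQ : π.map Prod.snd = Q)
    (α : ℝ) (hα0 : 0 ≤ α) (hα1 : α < 1) (g : Ω → ℝ)
    (hgP : Integrable g P) (hgQ : Integrable g Q) :
    |avar α P g - avar α Q g| ≤ (1 - α)⁻¹ * ∫ z, |g z.1 - g z.2| ∂π := by
  have i1 : Integrable (fun z : Ω × Ω => g z.1) π := by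
    subst hP; exact hgP.comp_measurable measurable_fst
  have i2 : Integrable (fun z : Ω × Ω => g z.2) π := by
    subst hQ; exact hgQ.comp_measurable measurable_snd
  have hpos : 0 ≤ (1 - α)⁻¹ := inv_nonneg.2 (by linarith)
  have key : ∀ q : ℝ, |(∫ ω, max (g ω - q) 0 ∂P) - ∫ ω, max (g ω - q) 0 ∂Q|
      ≤ ∫ z, |g z.1 - g z.2| ∂π := by
    intro q
    have e1 : ∫ ω, max (g ω - q) 0 ∂P = ∫ z, max (g z.1 - q) 0 ∂π := by
      have := (avar_aux_int P g hgP q).aestronglyMeasurable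
      subst hP
      exact integral_map measurable_fst.aemeasurable this
    have e2 : ∫ ω, max (g ω - q) 0 ∂Q = ∫ z, max (g z.2 - q) 0 ∂π := by
      have := (avar_aux_int Q g hgQ q).aestronglyMeasurable
      subst hQ
      exact integral_map measurable_snd.aemeasurable this
    have j1 := avar_aux_int π _ i1 q
    have j2 := avar_aux_int π _ i2 q
    rw [e1, e2, ← integral_sub j1 j2]
    refine (abs_integral_le_integral_abs).trans ?_
    refine integral_mono (j1.sub j2).abs (i1.sub i2).abs (fun z => ?_)
    have := abs_max_sub_max_le_abs (g z.1 - q) (g z.2 - q) 0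
    simpa using this
  have b1 := avar_aux_bdd P α hα0 hα1 g hgP
  have b2 := avar_aux_bdd Q α hα0 hα1 g hgQ
  rw [abs_sub_le_iff]
  constructor
  · rw [sub_le_iff_le_add, ← sub_le_iff_le_add']
    refine le_ciInf fun q => ?_
    have := ciInf_le b1 q
    have k := mul_le_mul_of_nonneg_left (abs_sub_le_iff.1 (key q)).1 hpos
    unfold avar
    linarith
  · rw [sub_le_iff_le_add, ← sub_le_iff_le_add']
    refine le_ciInf fun q => ?_
    have := ciInf_le b2 q
    have k := mul_le_mul_of_nonneg_left (abs_sub_le_iff.1 (key q)).2 hpos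
    unfold avar
    linarith

/-- Hölder plus monotonicity of Lp norms. -/
lemma holder_aux {Ω : Type*} [MeasurableSpace Ω] (π : Measure Ω) [IsProbabilityMeasure π]
    (k m : Ω → ℝ≥0∞) (hk : Measurable k) (hm : Measurable m) (r t : ℝ) (hr : 2 ≤ r) (ht : 2 ≤ t) :
    ∫⁻ z, k z * m z ∂π ≤ (∫⁻ z, k z ^ r ∂π) ^ (1 / r) * (∫⁻ z, m z ^ t ∂π) ^ (1 / t) := by
  have hc : (2:ℝ).HolderConjugate 2 := Real.HolderConjugate.two_two
  have h := ENNReal.lintegral_mul_le_Lp_mul_Lq π hc hk.aemeasurable hm.aemeasurable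
  have e : ∀ (f : Ω → ℝ≥0∞) (s : ℝ), Measurable f → 2 ≤ s →
      (∫⁻ z, f z ^ (2:ℝ) ∂π) ^ (1 / (2:ℝ)) ≤ (∫⁻ z, f z ^ s ∂π) ^ (1 / s) := by
    intro f s hf hs
    have := eLpNorm'_le_eLpNorm'_of_exponent_le (μ := π) (f := f) (p := 2) (q := s) (by norm_num) hs
      hf.aestronglyMeasurable
    simpa [eLpNorm'] using this
  exact h.trans (mul_le_mul' (e k r hk hr) (e m t hm ht))

/-- for a measurable, locally `β`-Hölder map `S` (reference point `x₀`,
nondecreasing local Hölder constant function `CS`), a Lipschitz quantity of interest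
`φ` with constant `C_φ`, and `P, Q ∈ P_{2βp}(X)` whose `2p`-th moments of
`CS(d(·,x₀))` are bounded by `C`, with `φ ∘ S` integrable for `P` and `Q`, one has
`|AVaR_{α,P}(φ∘S) - AVaR_{α,Q}(φ∘S)| ≤ 2 (1-α)⁻¹ C_φ C^{1/(2p)} d_{2p}(P,Q)^β`. -/
theorem avar_sensitivity_locally_holder {X U : Type*}
    [MetricSpace X] [MeasurableSpace X] [BorelSpace X]
    [MetricSpace U] [MeasurableSpace U] [BorelSpace U]
    (β p α Cφ C : ℝ) (hβ0 : 0 < β) (hβ1 : β ≤ 1) (hp : 1 ≤ p)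
    (hα0 : 0 ≤ α) (hα1 : α < 1) (hCφ : 0 ≤ Cφ) (hC : 0 ≤ C)
    (x₀ : X) (CS : ℝ → ℝ) (hCS0 : ∀ r, 0 ≤ CS r) (hCSmono : MonotoneOn CS (Set.Ici 0))
    (S : X → U) (hSm : Measurable S)
    (hS : ∀ r : ℝ, 0 < r → ∀ x y : X, dist x x₀ ≤ r → dist y x₀ ≤ r →
      dist (S x) (S y) ≤ CS r * dist x y ^ β)
    (φ : U → ℝ) (hφ : ∀ u v : U, |φ u - φ v| ≤ Cφ * dist u v)
    (P Q : Measure X) [IsProbabilityMeasure P] [IsProbabilityMeasure Q]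
    (hP : memWassersteinSpace (2 * β * p) P) (hQ : memWassersteinSpace (2 * β * p) Q)
    (hPC : ∫⁻ x, ENNReal.ofReal (CS (dist x x₀) ^ (2 * p)) ∂P ≤ ENNReal.ofReal C)
    (hQC : ∫⁻ x, ENNReal.ofReal (CS (dist x x₀) ^ (2 * p)) ∂Q ≤ ENNReal.ofReal C)
    (hintP : Integrable (fun x => φ (S x)) P)
    (hintQ : Integrable (fun x => φ (S x)) Q) :
    ENNReal.ofReal |avar α P (fun x => φ (S x)) - avar α Q (fun x => φ (S x))|
      ≤ ENNReal.ofReal (2 * (1 - α)⁻¹ * Cφ * C ^ (1 / (2 * p)))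
          * wassersteinDist (2 * p) P Q ^ β := by
  have hmCS : Measurable (fun x : X => CS (dist x x₀)) := by
    have hmono : Monotone (fun r : ℝ => CS (max r 0)) := fun a b hab =>
      hCSmono (le_max_right a 0) (le_max_right b 0) (max_le_max_right 0 hab)
    have h1 : Measurable (fun x : X => CS (max (dist x x₀) 0)) :=
      hmono.measurable.comp (continuous_id.dist continuous_const).measurable
    simpa using h1
  have hφc : Continuous φ := by
    have : LipschitzWith (Real.toNNReal Cφ) φ := by
      refine LipschitzWith.of_dist_le_mul fun u v => ?_
      rw [Real.dist_eq, Real.coe_toNNReal _ hCφ]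
      exact hφ u v
    exact this.continuous
  have hgm : Measurable (fun x => φ (S x)) := hφc.measurable.comp hSm
  set g : X → ℝ := fun x => φ (S x) with hg
  have hr : 2 ≤ 2 * p := by linarith
  have hr0 : 0 < 2 * p := by linarith
  have ht : 2 ≤ 2 * p / β := by
    rw [le_div_iff₀ hβ0]; nlinarith
  have hpos : 0 ≤ (1 - α)⁻¹ := inv_nonneg.2 (by linarith)
  -- pointwise bound
  have hpt : ∀ x y : X, |g x - g y| ≤ Cφ * max (CS (dist x x₀)) (CS (dist y x₀)) * dist x y ^ β := by
    intro x y
    have hmx : CS (max (dist x x₀) (dist y x₀)) ≤ max (CS (dist x x₀)) (CS (dist y x₀)) := by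
      rcases le_total (dist x x₀) (dist y x₀) with h | h
      · rw [max_eq_right h]; exact le_max_right _ _
      · rw [max_eq_left h]; exact le_max_left _ _
    have hnn : 0 ≤ dist x y ^ β := Real.rpow_nonneg dist_nonneg _
    rcases eq_or_ne x y with rfl | hxy
    · simp only [sub_self, abs_zero]
      exact mul_nonneg (mul_nonneg hCφ ((hCS0 _).trans (le_max_left _ _))) hnn
    have hR : 0 < max (dist x x₀) (dist y x₀) := by
      by_contra hcon
      push Not at hcon
      have h1 := (le_max_left _ _).trans hcon
      have h2 := (le_max_right _ _).trans hcon
      exact hxy ((dist_le_zero.1 h1).trans (dist_le_zero.1 h2).symm)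
    have h1 := hS _ hR x y (le_max_left _ _) (le_max_right _ _)
    calc |g x - g y| ≤ Cφ * dist (S x) (S y) := hφ _ _
      _ ≤ Cφ * (max (CS (dist x x₀)) (CS (dist y x₀)) * dist x y ^ β) :=
        mul_le_mul_of_nonneg_left (h1.trans (mul_le_mul_of_nonneg_right hmx hnn)) hCφ
      _ = _ := by ring
  -- bound for each coupling
  have main : ∀ π : Measure (X × X), (π.map Prod.fst = P ∧ π.map Prod.snd = Q) →
      ENNReal.ofReal |avar α P g - avar α Q g|
      ≤ ENNReal.ofReal (2 * (1 - α)⁻¹ * Cφ * C ^ (1 / (2 * p)))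
          * ((∫⁻ q, edist q.1 q.2 ^ (2 * p) ∂π) ^ (1 / (2 * p))) ^ β := by
    rintro π ⟨h1, h2⟩
    have : IsProbabilityMeasure π := by
      constructor
      have : P Set.univ = 1 := measure_univ
      rwa [← h1, Measure.map_apply measurable_fst MeasurableSet.univ, Set.preimage_univ] at this
    let K : X × X → ℝ := fun z => max (CS (dist z.1 x₀)) (CS (dist z.2 x₀))
    let M : X × X → ℝ := fun z => |g z.1 - g z.2| / (Cφ * K z)
    have hKm : Measurable K := (hmCS.comp measurable_fst).max (hmCS.comp measurable_snd)
    have hdm : Measurable (fun z : X × X => |g z.1 - g z.2|) := by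
      have := (hgm.comp measurable_fst).sub (hgm.comp measurable_snd)
      simpa using this.norm
    have hMm : Measurable M := hdm.div (hKm.const_mul Cφ)
    have hK0 : ∀ z, 0 ≤ K z := fun z => (hCS0 _).trans (le_max_left _ _)
    have hM0 : ∀ z, 0 ≤ M z := fun z => div_nonneg (abs_nonneg _) (mul_nonneg hCφ (hK0 z))
    have hMd : ∀ z, M z ≤ dist z.1 z.2 ^ β := fun z =>
      div_le_of_le_mul₀ (mul_nonneg hCφ (hK0 z)) (Real.rpow_nonneg dist_nonneg _)
        ((hpt z.1 z.2).trans (le_of_eq (mul_comm _ _)))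
    have hhe : ∀ z, |g z.1 - g z.2| ≤ Cφ * (K z * M z) := by
      intro z
      rcases eq_or_ne (Cφ * K z) 0 with h | h
      · have := hpt z.1 z.2
        change _ ≤ Cφ * K z * _ at this
        rw [← mul_assoc, h]; rw [h] at this; simpa using this
      · rw [← mul_assoc]
        exact (mul_div_cancel₀ _ h).ge
    have i1 : Integrable (fun z : X × X => g z.1) π := by
      have : Integrable g (π.map Prod.fst) := by rw [h1]; exact hintP
      exact this.comp_measurable measurable_fst
    have i2 : Integrable (fun z : X × X => g z.2) π := by
      have : Integrable g (π.map Prod.snd) := by rw [h2]; exact hintQ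
      exact this.comp_measurable measurable_snd
    have hA := avar_aux_le π P Q h1 h2 α hα0 hα1 g hintP hintQ
    have hB : ENNReal.ofReal (∫ z, |g z.1 - g z.2| ∂π) = ∫⁻ z, ENNReal.ofReal |g z.1 - g z.2| ∂π :=
      ofReal_integral_eq_lintegral_ofReal (i1.sub i2).abs
        (Filter.Eventually.of_forall fun z => abs_nonneg _)
    have hCc : ∫⁻ z, ENNReal.ofReal |g z.1 - g z.2| ∂π ≤
        ENNReal.ofReal Cφ * ∫⁻ z, ENNReal.ofReal (K z) * ENNReal.ofReal (M z) ∂π := by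
      have hKM : Measurable fun z => ENNReal.ofReal (K z) * ENNReal.ofReal (M z) :=
        hKm.ennreal_ofReal.mul hMm.ennreal_ofReal
      rw [← lintegral_const_mul _ hKM]
      refine lintegral_mono fun z => ?_
      rw [← ENNReal.ofReal_mul (hK0 z), ← ENNReal.ofReal_mul hCφ]
      exact ENNReal.ofReal_le_ofReal (hhe z)
    have hH := holder_aux π _ _ hKm.ennreal_ofReal hMm.ennreal_ofReal (2 * p) (2 * p / β) hr ht
    have hKb : (∫⁻ z, ENNReal.ofReal (K z) ^ (2 * p) ∂π) ^ (1 / (2 * p)) ≤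
        2 * ENNReal.ofReal (C ^ (1 / (2 * p))) := by
      have hf : Measurable fun x : X => ENNReal.ofReal (CS (dist x x₀) ^ (2 * p)) :=
        (hmCS.pow_const _).ennreal_ofReal
      have s1 : ∫⁻ z, ENNReal.ofReal (K z) ^ (2 * p) ∂π ≤
          ∫⁻ z, (ENNReal.ofReal (CS (dist z.1 x₀) ^ (2 * p))
            + ENNReal.ofReal (CS (dist z.2 x₀) ^ (2 * p))) ∂π := by
        refine lintegral_mono fun z => ?_
        rw [ENNReal.ofReal_rpow_of_nonneg (hK0 z) hr0.le]
        rcases le_total (CS (dist z.1 x₀)) (CS (dist z.2 x₀)) with h | h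
        · simp only [K, max_eq_right h]; exact le_add_self
        · simp only [K, max_eq_left h]; exact le_self_add
      have s2 : ∫⁻ z, ENNReal.ofReal (K z) ^ (2 * p) ∂π ≤ 2 * ENNReal.ofReal C := by
        refine s1.trans ?_
        have hf1 : Measurable fun z : X × X => ENNReal.ofReal (CS (dist z.1 x₀) ^ (2 * p)) :=
          hf.comp measurable_fst
        rw [lintegral_add_left hf1, two_mul (ENNReal.ofReal C)]
        refine add_le_add ?_ ?_
        · rw [← h1, lintegral_map hf measurable_fst] at hPC; exact hPC
        · rw [← h2, lintegral_map hf measurable_snd] at hQC; exact hQC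
      have hi : 0 ≤ 1 / (2 * p) := by positivity
      refine (ENNReal.rpow_le_rpow s2 hi).trans ?_
      rw [ENNReal.mul_rpow_of_nonneg _ _ hi, ENNReal.ofReal_rpow_of_nonneg hC hi]
      gcongr
      have : (2:ℝ≥0∞) ^ (1 / (2 * p)) ≤ 2 ^ (1:ℝ) :=
        ENNReal.rpow_le_rpow_of_exponent_le (by norm_num)
          (by rw [div_le_one hr0]; linarith)
      simpa using this
    have hMb : (∫⁻ z, ENNReal.ofReal (M z) ^ (2 * p / β) ∂π) ^ (1 / (2 * p / β)) ≤
        ((∫⁻ q, edist q.1 q.2 ^ (2 * p) ∂π) ^ (1 / (2 * p))) ^ β := by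
      rw [← ENNReal.rpow_mul]
      have e : 1 / (2 * p / β) = 1 / (2 * p) * β := by field_simp
      rw [e]
      refine ENNReal.rpow_le_rpow (lintegral_mono fun z => ?_) (by positivity)
      calc ENNReal.ofReal (M z) ^ (2 * p / β)
          ≤ (edist z.1 z.2 ^ β) ^ (2 * p / β) := by
            refine ENNReal.rpow_le_rpow ?_ (by positivity)
            rw [edist_dist, ENNReal.ofReal_rpow_of_nonneg dist_nonneg hβ0.le]
            exact ENNReal.ofReal_le_ofReal (hMd z)
        _ = edist z.1 z.2 ^ (2 * p) := by
            rw [← ENNReal.rpow_mul]; congr 1; field_simp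
    calc ENNReal.ofReal |avar α P g - avar α Q g|
        ≤ ENNReal.ofReal ((1 - α)⁻¹) * ∫⁻ z, ENNReal.ofReal |g z.1 - g z.2| ∂π := by
          rw [← hB, ← ENNReal.ofReal_mul hpos]
          exact ENNReal.ofReal_le_ofReal hA
      _ ≤ ENNReal.ofReal ((1 - α)⁻¹) * (ENNReal.ofReal Cφ *
          ((2 * ENNReal.ofReal (C ^ (1 / (2 * p)))) *
            ((∫⁻ q, edist q.1 q.2 ^ (2 * p) ∂π) ^ (1 / (2 * p))) ^ β)) :=
          mul_le_mul_right (hCc.trans (mul_le_mul_right (hH.trans (mul_le_mul' hKb hMb)) _)) _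
      _ = _ := by
          rw [ENNReal.ofReal_mul (by positivity), ENNReal.ofReal_mul (by positivity),
            ENNReal.ofReal_mul (by positivity), ENNReal.ofReal_ofNat]
          ring
  -- pass to the infimum
  set c := ENNReal.ofReal (2 * (1 - α)⁻¹ * Cφ * C ^ (1 / (2 * p))) with hc
  rcases eq_or_ne c 0 with h0 | h0
  · have := main (P.prod Q) ⟨by simp, by simp⟩
    rw [h0, zero_mul] at this
    exact this.trans zero_le
  · have hct : c ≠ ⊤ := ENNReal.ofReal_ne_top
    rw [← ENNReal.div_le_iff' h0 hct, ← ENNReal.rpow_inv_le_iff hβ0]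
    unfold wassersteinDist
    refine le_iInf₂ fun π hπ => ?_
    rw [ENNReal.rpow_inv_le_iff hβ0, ENNReal.div_le_iff' h0 hct]
    exact main π hπ
end

section
/- Let σ_max > 0, ρ_min > 0, and k_max ∈ ℕ. Then for every σ ∈ (0, σ_max], every ρ ≥ ρ_min, every k ∈ {0, 1, …, k_max}, and all x, y ∈ ℝ^d, the half-integer Matérn covariance function c := c_{σ²,ρ,k+1/2} satisfies c(x,x) + c(y,y) − 2·c(x,y) ≤ 2·σ_max² · ( 1 − exp( −√(2 k_max + 1)·|x−y| / ρ_min ) ). -/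
open scoped BigOperators

/-- The half-integer Matérn covariance function with variance `σ2`, length scale
`ρ` and shape parameter `k + 1/2`, as a function of the distance `t`. -/
noncomputable def maternHalfInt (σ2 ρ : ℝ) (k : ℕ) (t : ℝ) : ℝ :=
  σ2 * ((Nat.factorial k : ℝ) / (Nat.factorial (2 * k) : ℝ)) *
    (∑ i ∈ Finset.range (k + 1),
      (Nat.factorial (k + i) : ℝ) /
          ((Nat.factorial i : ℝ) * (Nat.factorial (k - i) : ℝ)) *
        (2 * Real.sqrt (2 * (k : ℝ) + 1) * t / ρ) ^ (k - i)) *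
    Real.exp (-(Real.sqrt (2 * (k : ℝ) + 1) * t / ρ))

theorem matern_zero (s r : ℝ) (k : ℕ) : maternHalfInt s r k 0 = s := by
  unfold maternHalfInt
  rw [Finset.sum_range_succ, Finset.sum_eq_zero]
  · have h1 : (Nat.factorial k : ℝ) ≠ 0 := by positivity
    have h2 : (Nat.factorial (2 * k) : ℝ) ≠ 0 := by positivity
    simp [← two_mul]
    field_simp
  · intro i hi
    have : k - i ≠ 0 := by
      have := Finset.mem_range.1 hi
      omega
    simp [this]

theorem matern_ge (s r : ℝ) (hs : 0 ≤ s) (hr : 0 < r) (k : ℕ) (t : ℝ) (ht : 0 ≤ t) :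
    s * Real.exp (-(Real.sqrt (2 * (k : ℝ) + 1) * t / r)) ≤ maternHalfInt s r k t := by
  unfold maternHalfInt
  refine mul_le_mul_of_nonneg_right ?_ (Real.exp_pos _).le
  rw [Finset.sum_range_succ, mul_add]
  have h1 : (Nat.factorial k : ℝ) ≠ 0 := by positivity
  have h2 : (Nat.factorial (2 * k) : ℝ) ≠ 0 := by positivity
  have h3 : s * ((Nat.factorial k : ℝ) / (Nat.factorial (2 * k) : ℝ)) *
      ((Nat.factorial (k + k) : ℝ) / ((Nat.factorial k : ℝ) * (Nat.factorial (k - k) : ℝ)) *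
        (2 * Real.sqrt (2 * (k : ℝ) + 1) * t / r) ^ (k - k)) = s := by
    simp [← two_mul]
    field_simp
  rw [h3]
  refine le_add_of_nonneg_left (mul_nonneg (by positivity) (Finset.sum_nonneg fun i _ => ?_))
  positivity

/-- uniform bound for the Matérn increment variance. For parameters
`σ ∈ (0, σ_max]`, `ρ ≥ ρ_min`, `k ≤ k_max`, the half-integer Matérn covariance
`c = c_{σ²,ρ,k+1/2}` satisfies
`c(x,x) + c(y,y) - 2 c(x,y) ≤ 2 σ_max² (1 - exp(-√(2k_max+1)·|x-y|/ρ_min))`. -/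
theorem matern_increment_bound (d : ℕ) (σmax ρmin : ℝ) (kmax : ℕ)
    (hσmax : 0 < σmax) (hρmin : 0 < ρmin)
    (σ ρ : ℝ) (hσ0 : 0 < σ) (hσ : σ ≤ σmax) (hρ : ρmin ≤ ρ)
    (k : ℕ) (hk : k ≤ kmax)
    (x y : EuclideanSpace ℝ (Fin d)) :
    maternHalfInt (σ ^ 2) ρ k (dist x x) + maternHalfInt (σ ^ 2) ρ k (dist y y)
        - 2 * maternHalfInt (σ ^ 2) ρ k (dist x y)
      ≤ 2 * σmax ^ 2 *
          (1 - Real.exp (-(Real.sqrt (2 * (kmax : ℝ) + 1) * dist x y / ρmin))) := by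
  rw [dist_self, dist_self, matern_zero]
  have hr : 0 < ρ := hρmin.trans_le hρ
  have h := matern_ge (σ ^ 2) ρ (sq_nonneg σ) hr k (dist x y) dist_nonneg
  have hkk : (k : ℝ) ≤ kmax := by exact_mod_cast hk
  have he : Real.sqrt (2 * (k : ℝ) + 1) * dist x y / ρ
      ≤ Real.sqrt (2 * (kmax : ℝ) + 1) * dist x y / ρmin := by
    gcongr
  have h1 := Real.exp_le_exp.2 (neg_le_neg he)
  have h2 : Real.exp (-(Real.sqrt (2 * (kmax : ℝ) + 1) * dist x y / ρmin)) ≤ 1 :=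
    Real.exp_le_one_iff.2 (neg_nonpos.2 (by positivity))
  have h3 : σ ^ 2 ≤ σmax ^ 2 := by gcongr
  have h4 := mul_le_mul_of_nonneg_left h1 (sq_nonneg σ)
  have h5 := mul_le_mul_of_nonneg_right h3 (sub_nonneg.2 h2)
  linarith
end

section
/- Let n ≥ 1, let D ⊆ ℝⁿ be a nonempty bounded set, and let σ > 0, ρ̂ > 0. Define the metric d on ℝⁿ by d(x,y) := σ·√2·√( 1 − exp( −|x−y|/ρ̂ ) ), where |x−y| is the Euclidean distance. Then for every r > 0 the covering number N(D, d, r) is finite, and the entropy integral is finite: ∫₀^∞ √( log N(D, d, r) ) dr < ∞ (the integrand vanishes for all r with N(D,d,r) = 1, in particular for r ≥ σ·√2). -/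
open scoped ENNReal

/-- The covering number of a set `D` with respect to a distance function `d` and
radius `r`: the smallest cardinality of a finite set of centers whose closed
`d`-balls of radius `r` cover `D` (`⊤` if no finite cover exists). -/
noncomputable def coveringNumber {M : Type*} (d : M → M → ℝ) (D : Set M) (r : ℝ) : ℕ∞ :=
  sInf ((fun s : Finset M => (s.card : ℕ∞)) ''
    {s : Finset M | D ⊆ ⋃ x ∈ s, {y | d x y ≤ r}})

lemma coveringNumber_le_card {M : Type*} (d : M → M → ℝ) (D : Set M) (r : ℝ) (s : Finset M)
    (h : D ⊆ ⋃ x ∈ s, {y | d x y ≤ r}) : coveringNumber d D r ≤ (s.card : ℕ∞) :=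
  sInf_le ⟨s, h, rfl⟩

lemma exists_grid (n : ℕ) (hn : 1 ≤ n) (R δ : ℝ) (hR : 0 ≤ R) (hδ : 0 < δ) :
    ∃ s : Finset (EuclideanSpace ℝ (Fin n)),
      (∀ y : EuclideanSpace ℝ (Fin n), ‖y‖ ≤ R → ∃ x ∈ s, dist x y ≤ δ) ∧
      (s.card : ℝ) ≤ (2 * (R * n / δ) + 5) ^ n := by
  classical
  have hn0 : (0 : ℝ) < n := by exact_mod_cast hn
  set e : ℝ := δ / n with he
  have he0 : 0 < e := by positivity
  set m : ℕ := ⌈R / e⌉₊ + 1 with hm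
  have hm1 : R / e + 1 ≤ m := by
    rw [hm]; push_cast; linarith [Nat.le_ceil (R / e)]
  have hm2 : (m : ℝ) ≤ R / e + 2 := by
    rw [hm]; push_cast; linarith [Nat.ceil_lt_add_one (show 0 ≤ R / e by positivity)]
  refine ⟨(Fintype.piFinset (fun _ : Fin n => Finset.Icc (-(m : ℤ)) m)).image
    (fun k => WithLp.toLp 2 (fun i => e * (k i : ℝ))), ?_, ?_⟩
  · intro y hy
    refine ⟨_, Finset.mem_image_of_mem _ (a := fun i => round (y i / e)) ?_, ?_⟩
    · rw [Fintype.mem_piFinset]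
      intro i
      have h1 : |y i| ≤ R := by
        have := PiLp.norm_apply_le y i
        rw [Real.norm_eq_abs] at this
        exact this.trans hy
      have h2 : |y i / e| ≤ R / e := by
        rw [abs_div, abs_of_pos he0]; gcongr
      have h3 := abs_le.1 (abs_sub_round (y i / e))
      have h4 := abs_le.1 h2
      rw [Finset.mem_Icc]
      constructor
      · have : (-(m : ℝ)) ≤ (round (y i / e) : ℝ) := by linarith
        exact_mod_cast this
      · have : (round (y i / e) : ℝ) ≤ (m : ℝ) := by linarith
        exact_mod_cast this
    · rw [EuclideanSpace.dist_eq]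
      apply Real.sqrt_le_iff.2 ⟨hδ.le, ?_⟩
      have key : ∀ i : Fin n, dist (e * (round (y i / e) : ℝ)) (y i) ^ 2 ≤ e ^ 2 := by
        intro i
        have h3 := abs_sub_round (y i / e)
        have h5 : dist (e * (round (y i / e) : ℝ)) (y i) = e * |y i / e - round (y i / e)| := by
          rw [dist_comm, Real.dist_eq, ← abs_of_pos he0, ← abs_mul, abs_of_pos he0]
          congr 1
          field_simp
        rw [h5]
        have : e * |y i / e - round (y i / e)| ≤ e := by nlinarith
        gcongr
      refine (Finset.sum_le_sum (fun i _ => key i)).trans ?_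
      rw [Finset.sum_const, Finset.card_univ, Fintype.card_fin, nsmul_eq_mul]
      have h1 : (1 : ℝ) ≤ n := by exact_mod_cast hn
      have h2 : δ = n * e := by rw [he]; field_simp
      rw [h2]
      nlinarith [sq_nonneg e, mul_nonneg (sub_nonneg.2 h1) (mul_nonneg hn0.le (sq_nonneg e))]
  · have h1 := Finset.card_image_le (s := Fintype.piFinset (fun _ : Fin n => Finset.Icc (-(m : ℤ)) m))
      (f := fun k => (WithLp.toLp 2 (fun i => e * (k i : ℝ)) : EuclideanSpace ℝ (Fin n)))
    have h2 : (Fintype.piFinset (fun _ : Fin n => Finset.Icc (-(m : ℤ)) m)).card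
        = (2 * m + 1) ^ n := by
      rw [Fintype.card_piFinset]
      simp only [Int.card_Icc, Finset.prod_const, Finset.card_univ, Fintype.card_fin]
      congr 1
      omega
    rw [h2] at h1
    have h3 : R * n / δ = R / e := by rw [he]; field_simp
    rw [h3]
    calc _ ≤ (((2 * m + 1) ^ n : ℕ) : ℝ) := by exact_mod_cast h1
      _ = (2 * (m : ℝ) + 1) ^ n := by push_cast; rfl
      _ ≤ _ := by
        gcongr ?_ ^ n
        linarith

/-- for a nonempty bounded set `D ⊆ ℝⁿ` and the metric
`d(x,y) = σ√2·√(1 - exp(-|x-y|/ρ̂))`, all covering numbers are finite and the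
entropy integral `∫₀^∞ √(log N(D,d,r)) dr` is finite. -/
theorem entropy_integral_finite (n : ℕ) (hn : 1 ≤ n)
    (D : Set (EuclideanSpace ℝ (Fin n))) (hD : D.Nonempty)
    (hb : Bornology.IsBounded D) (σ ρ : ℝ) (hσ : 0 < σ) (hρ : 0 < ρ) :
    (∀ r : ℝ, 0 < r →
      coveringNumber
        (fun x y => σ * Real.sqrt 2 * Real.sqrt (1 - Real.exp (-(dist x y / ρ))))
        D r ≠ ⊤) ∧
    ∫⁻ r in Set.Ioi (0 : ℝ),
        ENNReal.ofReal (Real.sqrt (Real.log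
          (((coveringNumber
              (fun x y => σ * Real.sqrt 2 * Real.sqrt (1 - Real.exp (-(dist x y / ρ))))
              D r).toNat : ℝ)))) < ⊤ := by
  classical
  set d : EuclideanSpace ℝ (Fin n) → EuclideanSpace ℝ (Fin n) → ℝ :=
    fun x y => σ * Real.sqrt 2 * Real.sqrt (1 - Real.exp (-(dist x y / ρ))) with hd
  have hn0 : (0 : ℝ) < n := by exact_mod_cast hn
  obtain ⟨R, hR0, hR⟩ : ∃ R : ℝ, 0 ≤ R ∧ ∀ y ∈ D, ‖y‖ ≤ R := by
    obtain ⟨R, hR⟩ := hb.exists_norm_le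
    exact ⟨max R 0, le_max_right _ _, fun y hy => (hR y hy).trans (le_max_left _ _)⟩
  have hdle : ∀ x y r, 0 < r → dist x y ≤ ρ * r ^ 2 / (2 * σ ^ 2) → d x y ≤ r := by
    intro x y r hr hxy
    have h1 : 1 - Real.exp (-(dist x y / ρ)) ≤ r ^ 2 / (2 * σ ^ 2) := by
      have h2 := Real.add_one_le_exp (-(dist x y / ρ))
      have h3 : dist x y / ρ ≤ r ^ 2 / (2 * σ ^ 2) := by
        rw [div_le_iff₀ hρ]
        calc _ ≤ _ := hxy
          _ = _ := by ring
      linarith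
    calc d x y ≤ σ * Real.sqrt 2 * Real.sqrt (r ^ 2 / (2 * σ ^ 2)) := by
          simp only [hd]; gcongr
      _ = r := by
          rw [Real.sqrt_div (by positivity), Real.sqrt_mul (by norm_num), Real.sqrt_sq hr.le,
            Real.sqrt_sq hσ.le]
          have : Real.sqrt 2 ≠ 0 := by positivity
          field_simp
  set A : ℝ := 2 * (R * n * (2 * σ ^ 2) / ρ) with hA
  have hA0 : 0 ≤ A := by positivity
  have hcov : ∀ r : ℝ, 0 < r → coveringNumber d D r ≠ ⊤ ∧
      ((coveringNumber d D r).toNat : ℝ) ≤ (A / r ^ 2 + 5) ^ n := by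
    intro r hr
    obtain ⟨s, hs, hc⟩ := exists_grid n hn R (ρ * r ^ 2 / (2 * σ ^ 2)) hR0 (by positivity)
    have hle : coveringNumber d D r ≤ (s.card : ℕ∞) := by
      apply coveringNumber_le_card
      intro y hy
      obtain ⟨x, hx, hxy⟩ := hs y (hR y hy)
      simp only [Set.mem_iUnion, Set.mem_setOf_eq]
      exact ⟨x, hx, hdle x y r hr hxy⟩
    refine ⟨ne_top_of_le_ne_top (ENat.coe_ne_top _) hle, ?_⟩
    have h1 : (coveringNumber d D r).toNat ≤ s.card := ENat.toNat_le_of_le_coe hle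
    have h2 : A / r ^ 2 = 2 * (R * n / (ρ * r ^ 2 / (2 * σ ^ 2))) := by
      rw [hA]; field_simp
    rw [h2]
    exact le_trans (by exact_mod_cast h1) hc
  refine ⟨fun r hr => (hcov r hr).1, ?_⟩
  set S : ℝ := σ * Real.sqrt 2 with hS
  have hS0 : 0 < S := by positivity
  have hbig : ∀ r : ℝ, S < r →
      ENNReal.ofReal (Real.sqrt (Real.log ((coveringNumber d D r).toNat : ℝ))) = 0 := by
    intro r hr
    obtain ⟨x, hx⟩ := hD
    have hle : coveringNumber d D r ≤ (({x} : Finset _).card : ℕ∞) := by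
      apply coveringNumber_le_card
      intro y hy
      simp only [Finset.mem_singleton, Set.iUnion_iUnion_eq_left, Set.mem_setOf_eq]
      have h1 : Real.sqrt (1 - Real.exp (-(dist x y / ρ))) ≤ 1 := by
        apply Real.sqrt_le_iff.2 ⟨zero_le_one, ?_⟩
        linarith [Real.exp_pos (-(dist x y / ρ))]
      have : d x y ≤ S * 1 := mul_le_mul_of_nonneg_left h1 hS0.le
      linarith
    have h1 : (coveringNumber d D r).toNat ≤ 1 := by
      simpa using ENat.toNat_le_of_le_coe hle
    have h2 : Real.log ((coveringNumber d D r).toNat : ℝ) ≤ 0 :=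
      Real.log_nonpos (by positivity) (by exact_mod_cast h1)
    rw [Real.sqrt_eq_zero_of_nonpos h2, ENNReal.ofReal_zero]
  set B : ℝ := A + 5 * S ^ 2 with hB
  have hB0 : 0 < B := by positivity
  have hsmall : ∀ r ∈ Set.Ioc 0 S,
      ENNReal.ofReal (Real.sqrt (Real.log ((coveringNumber d D r).toNat : ℝ))) ≤
      ENNReal.ofReal (1 + n * (Real.log B - 2 * Real.log r)) := by
    rintro r ⟨hr, hrS⟩
    apply ENNReal.ofReal_le_ofReal
    have h1 : A / r ^ 2 + 5 ≤ B / r ^ 2 := by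
      rw [hB, add_div]
      have : 5 ≤ 5 * S ^ 2 / r ^ 2 := by
        rw [le_div_iff₀ (by positivity)]; gcongr
      linarith
    have h2 : Real.log ((coveringNumber d D r).toNat : ℝ) ≤ n * (Real.log B - 2 * Real.log r) := by
      have h3 : n * (Real.log B - 2 * Real.log r) = Real.log ((B / r ^ 2) ^ n) := by
        rw [Real.log_pow, Real.log_div hB0.ne' (by positivity), Real.log_pow]; norm_num
      have h5 : 1 ≤ B / r ^ 2 := by
        have : 0 ≤ A / r ^ 2 := by positivity
        linarith
      rcases Nat.eq_zero_or_pos (coveringNumber d D r).toNat with h0 | h0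
      · rw [h0, h3]
        simp only [Nat.cast_zero, Real.log_zero]
        exact Real.log_nonneg (one_le_pow₀ h5)
      · rw [h3]
        apply Real.log_le_log (by exact_mod_cast h0)
        refine (hcov r hr).2.trans ?_
        gcongr
    have h6 : 0 ≤ Real.log ((coveringNumber d D r).toNat : ℝ) := Real.log_natCast_nonneg _
    refine Real.sqrt_le_iff.2 ⟨by linarith, ?_⟩
    nlinarith
  have hint : MeasureTheory.IntegrableOn
      (fun r : ℝ => 1 + n * (Real.log B - 2 * Real.log r)) (Set.Ioc 0 S) := by
    rw [← intervalIntegrable_iff_integrableOn_Ioc_of_le hS0.le]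
    exact intervalIntegrable_const.add
      ((intervalIntegrable_const.sub
        (intervalIntegral.intervalIntegrable_log'.const_mul 2)).const_mul _)
  rw [← Set.Ioc_union_Ioi_eq_Ioi hS0.le]
  refine (MeasureTheory.lintegral_union_le _ _ _).trans_lt ?_
  rw [MeasureTheory.setLIntegral_congr_fun (g := fun _ => 0) measurableSet_Ioi
    (fun r hr => hbig r hr)]
  rw [MeasureTheory.lintegral_zero, add_zero]
  refine (MeasureTheory.setLIntegral_mono' measurableSet_Ioc hsmall).trans_lt ?_
  exact hint.lintegral_lt_top
end
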